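/- If a graph G has an independent 2-thin cover 𝒳 = {X₁,…,X_k}, then rank₃(G) ≤ IE(G,𝒳), i.e., rank₃(G) ≤ ∑ᵢ rank₃(G_{S(𝒳)}[Xᵢ]) − ∑_{e ∈ S(𝒳)} (d(𝒳,e) − 1). -/

import Mathlib

noncomputable section

open scoped RealInnerProductSpace

namespace Rigidity

variable {V : Type*}

/-- The row of the rigidity matrix of the framework `p` corresponding to the
ordered pair `(x, y)`: it has `p x - p y` in the three columns of `x`,
`p y - p x` in the three columns of `y`, and `0` elsewhere. -/
def rigidityRow [DecidableEq V] (p : V → Fin 3 → ℝ) (x y : V) : V × Fin 3 → ℝ :=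
  fun vi =>
    (if vi.1 = x then p x vi.2 - p y vi.2 else 0) +
    (if vi.1 = y then p y vi.2 - p x vi.2 else 0)

/-- The rank of the rigidity matrix of the framework `(G, p)`, i.e. the dimension of
the span of its rows (one row for each edge of `G`). -/
def rigidityRank [DecidableEq V] (G : SimpleGraph V) (p : V → Fin 3 → ℝ) : ℕ :=
  Module.finrank ℝ
    (Submodule.span ℝ {w : V × Fin 3 → ℝ | ∃ x y, G.Adj x y ∧ w = rigidityRow p x y})

/-- The generic 3-dimensional rank `rank₃ G`: the maximum, over all frameworks `p`,
of the rank of the rigidity matrix `R(G, p)`. -/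
def genRank [DecidableEq V] (G : SimpleGraph V) : ℕ :=
  sSup {n : ℕ | ∃ p : V → Fin 3 → ℝ, n = rigidityRank G p}

/-- `G` is independent in the generic 3-dimensional rigidity matroid. -/
def IsIndependent [DecidableEq V] (G : SimpleGraph V) : Prop :=
  genRank G = G.edgeSet.ncard

/-- `G` is (generically) rigid in dimension 3: `rank₃ G = 3|V| - 6`. -/
def IsRigid [DecidableEq V] (G : SimpleGraph V) : Prop :=
  genRank G = 3 * Nat.card V - 6

/-- `G` is nucleation-free: it has no rigid subgraph on at least 5 vertices. -/
def NucleationFree [DecidableEq V] (G : SimpleGraph V) : Prop :=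
  ∀ H : G.Subgraph, 5 ≤ H.verts.ncard → ¬ IsRigid H.coe

/-- The graph `G + {x,y}` obtained from `G` by adding the edge `{x, y}`. -/
def addEdge (G : SimpleGraph V) (x y : V) : SimpleGraph V :=
  G ⊔ SimpleGraph.fromEdgeSet {s(x, y)}

/-- `{x, y}` is an implied nonedge of `G`: it is a nonedge and adding it
does not change the generic 3-dimensional rank. -/
def ImpliedNonedge [DecidableEq V] (G : SimpleGraph V) (x y : V) : Prop :=
  x ≠ y ∧ ¬ G.Adj x y ∧ genRank (addEdge G x y) = genRank G

/-- `G` is a circuit of the generic 3-dimensional rigidity matroid: it is dependent and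
deleting any one edge yields an independent graph. -/
def IsCircuit [DecidableEq V] (G : SimpleGraph V) : Prop :=
  ¬ IsIndependent G ∧ ∀ e ∈ G.edgeSet, IsIndependent (G.deleteEdges {e})

/-- The vertex set `W` is contained in some `K₄` subgraph of `G`. -/
def ContainedInK4 (G : SimpleGraph V) (W : Set V) : Prop :=
  ∃ s : Set V, W ⊆ s ∧ s.ncard = 4 ∧ G.IsClique s

/-- The canonical ring of `m` butterflies: vertices `(i, 0) = aᵢ`, `(i, 1) = bᵢ` and
`(i, 2) = eᵢ`; link `i` is the complete graph on `aᵢ, bᵢ, eᵢ, aᵢ₊₁, bᵢ₊₁` minus the two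
hinge pairs `{aᵢ, bᵢ}` and `{aᵢ₊₁, bᵢ₊₁}` (a butterfly). -/
def butterflyRing (m : ℕ) : SimpleGraph (ZMod m × Fin 3) :=
  SimpleGraph.fromRel fun x y =>
    (x.1 = y.1 ∧ x ≠ y ∧ (x.2 = 2 ∨ y.2 = 2)) ∨ (y.1 = x.1 + 1 ∧ y.2 ≠ 2)

/-- `G` is a ring of `m` butterflies with hinges `{a i, b i}`. -/
def IsRingOfButterflies (m : ℕ) (G : SimpleGraph V) (a b : ZMod m → V) : Prop :=
  ∃ φ : G ≃g butterflyRing m, (∀ i, φ (a i) = (i, 0)) ∧ (∀ i, φ (b i) = (i, 1))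

/-- `G` is a ring of `m` butterflies with vertex set `S`, vertex labelling `f`
(all vertices of `V` outside `S` being isolated in `G`). -/
def IsRingOfButterfliesOn (m : ℕ) (G : SimpleGraph V) (S : Set V)
    (f : ZMod m × Fin 3 → V) : Prop :=
  Function.Injective f ∧ Set.range f = S ∧ G.support ⊆ S ∧
    ∀ x y, G.Adj (f x) (f y) ↔ (butterflyRing m).Adj x y

/-- `R` is a ring with links `L i` (subgraphs of `R`) and hinges `{a i, b i}`:
the links cover `R`, the `2m` hinge vertices are pairwise distinct, link `i` contains the
hinge vertices `a i, b i, a (i+1), b (i+1)`, and two distinct links share only hinge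
vertices common to both of them. -/
def IsRingDecomp (m : ℕ) (R : SimpleGraph V) (L : ZMod m → R.Subgraph)
    (a b : ZMod m → V) : Prop :=
  (⨆ i, (L i).spanningCoe) = R ∧
  Function.Injective (fun x : ZMod m × Bool => if x.2 then a x.1 else b x.1) ∧
  (∀ i, a i ∈ (L i).verts ∧ b i ∈ (L i).verts ∧
    a (i + 1) ∈ (L i).verts ∧ b (i + 1) ∈ (L i).verts) ∧
  (∀ i j, i ≠ j →
    (L i).verts ∩ (L j).verts ⊆
      ({a i, b i, a (i + 1), b (i + 1)} : Set V) ∩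
        ({a j, b j, a (j + 1), b (j + 1)} : Set V))

/-- The shared set `S(𝒳)` of a cover: all pairs `{x, y}` of distinct vertices such that
`{x, y} = X ∩ Y` for two distinct clusters `X, Y` of `𝒳`. -/
def sharedSet (𝒳 : Finset (Set V)) : Set (Sym2 V) :=
  {e | ∃ x y : V, x ≠ y ∧ e = s(x, y) ∧ ∃ X ∈ 𝒳, ∃ Y ∈ 𝒳, X ≠ Y ∧ X ∩ Y = {x, y}}

/-- `d(𝒳, e)`: the number of clusters of `𝒳` containing both endpoints of `e`. -/
def coverDeg (𝒳 : Finset (Set V)) (e : Sym2 V) : ℕ :=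
  {X : Set V | X ∈ 𝒳 ∧ ∀ v ∈ e, v ∈ X}.ncard

/-- `𝒳` is a 2-thin cover of `G`. -/
def IsTwoThinCover (G : SimpleGraph V) (𝒳 : Finset (Set V)) : Prop :=
  (∀ X ∈ 𝒳, 2 ≤ X.ncard) ∧
  (∀ X ∈ 𝒳, ∀ Y ∈ 𝒳, X ≠ Y → (X ∩ Y).ncard ≤ 2 ∧ ¬ X ⊂ Y) ∧
  (∀ x y : V, G.Adj x y → ∃ X ∈ 𝒳, x ∈ X ∧ y ∈ X)

/-- `Gs` is a nonedge-split of `G` at the nonedge `{a, b}` with new vertices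
`a₁, a₂, b₁, b₂`: the neighborhoods of `a₁, a₂` partition the neighborhood of `a`, the
neighborhoods of `b₁, b₂` partition the neighborhood of `b`, and `a`, `b` are deleted
(i.e. become isolated). -/
def IsNonedgeSplit (G Gs : SimpleGraph V) (a b a₁ a₂ b₁ b₂ : V) : Prop :=
  ¬ G.Adj a b ∧
  ([a, b, a₁, a₂, b₁, b₂] : List V).Pairwise (· ≠ ·) ∧
  a₁ ∉ G.support ∧ a₂ ∉ G.support ∧ b₁ ∉ G.support ∧ b₂ ∉ G.support ∧
  ∃ A ⊆ G.neighborSet a, ∃ B ⊆ G.neighborSet b,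
    Gs = (G.deleteEdges {e | a ∈ e ∨ b ∈ e}) ⊔
      SimpleGraph.fromEdgeSet
        (((fun w => s(a₁, w)) '' A) ∪ ((fun w => s(a₂, w)) '' (G.neighborSet a \ A)) ∪
         ((fun w => s(b₁, w)) '' B) ∪ ((fun w => s(b₂, w)) '' (G.neighborSet b \ B)))

/-- The double-butterfly on the eight vertices `a₁, a₂, b₁, b₂, u, v, c, c'`. -/
def doubleButterfly (a₁ a₂ b₁ b₂ u v c c' : V) : SimpleGraph V :=
  SimpleGraph.fromEdgeSet
    {s(a₁, u), s(a₁, v), s(a₂, u), s(a₂, v), s(b₁, u), s(b₁, v), s(b₂, u), s(b₂, v),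
     s(c, a₁), s(c, b₁), s(c, u), s(c, v), s(c', a₂), s(c', b₂), s(c', u), s(c', v)}

/-- `G'` is obtained from `G` by a double-butterfly split-and-glue at the nonedge
`{a, b}`: a nonedge-split of `G` at `{a, b}` with new vertices `a₁, a₂, b₁, b₂`, followed by
gluing a double-butterfly (with fresh vertices `u, v, c, c'`) along `a₁, a₂, b₁, b₂`. -/
def IsDoubleButterflySG (G G' : SimpleGraph V)
    (a b a₁ a₂ b₁ b₂ u v c c' : V) : Prop :=
  ∃ Gs : SimpleGraph V, IsNonedgeSplit G Gs a b a₁ a₂ b₁ b₂ ∧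
    ([a, b, a₁, a₂, b₁, b₂, u, v, c, c'] : List V).Pairwise (· ≠ ·) ∧
    u ∉ G.support ∧ v ∉ G.support ∧ c ∉ G.support ∧ c' ∉ G.support ∧
    G' = Gs ⊔ doubleButterfly a₁ a₂ b₁ b₂ u v c c'

/-- `s` is an equilibrium self-stress of the framework `(G, p)`. -/
def IsSelfStress [Fintype V] (G : SimpleGraph V) [DecidableRel G.Adj]
    (p : V → EuclideanSpace ℝ (Fin 3)) (s : Sym2 V → ℝ) : Prop :=
  ∀ x : V, (∑ y : V, if G.Adj x y then s s(x, y) • (p x - p y) else 0) = 0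

/-- `K(U)`: the edge set of the complete graph on the vertex set `U`. -/
def completeOn (U : Set V) : Set (Sym2 V) :=
  {e | ¬ e.IsDiag ∧ ∀ v ∈ e, v ∈ U}

/-- `V(E)`: the set of endpoints of the pairs in `E`. -/
def vertexSet (E : Set (Sym2 V)) : Set V := {v | ∃ e ∈ E, v ∈ e}

/-- `M` is an abstract `d`-rigidity matroid (axioms C1 and C2). -/
def IsAbstractRigidityMatroid (d : ℕ) (M : Matroid (Sym2 V)) : Prop :=
  (∀ E₁ E₂ : Set (Sym2 V), E₁ ⊆ M.E → E₂ ⊆ M.E →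
     (vertexSet E₁ ∩ vertexSet E₂).ncard ≤ d - 1 →
     M.closure (E₁ ∪ E₂) ⊆ completeOn (vertexSet E₁) ∪ completeOn (vertexSet E₂)) ∧
  (∀ E₁ E₂ : Set (Sym2 V), E₁ ⊆ M.E → E₂ ⊆ M.E →
     d ≤ (vertexSet E₁ ∩ vertexSet E₂).ncard →
     M.closure E₁ = completeOn (vertexSet E₁) →
     M.closure E₂ = completeOn (vertexSet E₂) →
     M.closure (E₁ ∪ E₂) = completeOn (vertexSet E₁ ∪ vertexSet E₂))

/-- The row of the rigidity matrix of `p` indexed by an unordered pair. -/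
def edgeRow [DecidableEq V] (p : V → Fin 3 → ℝ) : Sym2 V → V × Fin 3 → ℝ :=
  Sym2.lift ⟨rigidityRow p, fun x y => by
    funext vi
    simp only [rigidityRow]
    exact add_comm _ _⟩

@[simp]
theorem edgeRow_mk [DecidableEq V] (p : V → Fin 3 → ℝ) (x y : V) :
    edgeRow p s(x, y) = rigidityRow p x y := rfl

theorem edgeRow_add_smul [DecidableEq V] (p q : V → Fin 3 → ℝ) (t : ℝ) (e : Sym2 V) :
    edgeRow (p + t • q) e = edgeRow p e + t • edgeRow q e := by
  induction e with
  | _ x y =>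
    funext vi
    simp only [edgeRow_mk, rigidityRow, Pi.add_apply, Pi.smul_apply, smul_eq_mul]
    split_ifs <;> ring

/-- The dimension of the span of the image of `E` under `f`. -/
def spanRank {α M : Type*} [AddCommGroup M] [Module ℝ M] (f : α → M) (E : Set α) : ℕ :=
  Module.finrank ℝ (Submodule.span ℝ (f '' E))

theorem rigidityRank_eq_spanRank [DecidableEq V] (G : SimpleGraph V) (p : V → Fin 3 → ℝ) :
    rigidityRank G p = spanRank (edgeRow p) G.edgeSet := by
  unfold rigidityRank spanRank
  suffices h : {w : V × Fin 3 → ℝ | ∃ x y, G.Adj x y ∧ w = rigidityRow p x y} =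
      edgeRow p '' G.edgeSet by rw [h]
  ext w
  constructor
  · rintro ⟨x, y, h, rfl⟩
    exact ⟨s(x, y), h, rfl⟩
  · rintro ⟨e, he, rfl⟩
    induction e with
    | _ x y => exact ⟨x, y, he, rfl⟩

theorem bddAbove_rigidityRank [Finite V] [DecidableEq V] (G : SimpleGraph V) :
    BddAbove {n : ℕ | ∃ p : V → Fin 3 → ℝ, n = rigidityRank G p} := by
  refine ⟨Module.finrank ℝ (V × Fin 3 → ℝ), ?_⟩
  rintro n ⟨p, rfl⟩
  exact Submodule.finrank_le _

theorem rigidityRank_le_genRank [Finite V] [DecidableEq V] (G : SimpleGraph V)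
    (p : V → Fin 3 → ℝ) : rigidityRank G p ≤ genRank G :=
  le_csSup (bddAbove_rigidityRank G) ⟨p, rfl⟩

theorem exists_rigidityRank_eq_genRank [Finite V] [DecidableEq V] (G : SimpleGraph V) :
    ∃ p : V → Fin 3 → ℝ, rigidityRank G p = genRank G := by
  obtain ⟨p, hp⟩ := Nat.sSup_mem
    (s := {n : ℕ | ∃ p : V → Fin 3 → ℝ, n = rigidityRank G p}) ⟨_, 0, rfl⟩ (bddAbove_rigidityRank G)
  exact ⟨p, hp.symm⟩

section LinearAlgebra

variable {α M : Type*} [AddCommGroup M] [Module ℝ M]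

theorem spanRank_mono [FiniteDimensional ℝ M] (f : α → M) {E F : Set α} (h : E ⊆ F) :
    spanRank f E ≤ spanRank f F :=
  Submodule.finrank_mono (Submodule.span_mono (Set.image_mono h))

/-- Submodularity of `spanRank`. -/
theorem spanRank_union_add_inter_le [FiniteDimensional ℝ M] (f : α → M) (A E : Set α) :
    spanRank f (A ∪ E) + spanRank f (E ∩ A) ≤ spanRank f A + spanRank f E := by
  have h := Submodule.finrank_sup_add_finrank_inf_eq
    (Submodule.span ℝ (f '' A)) (Submodule.span ℝ (f '' E))
  have h' : spanRank f (E ∩ A) ≤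
      Module.finrank ℝ ↥(Submodule.span ℝ (f '' A) ⊓ Submodule.span ℝ (f '' E)) :=
    Submodule.finrank_mono (le_inf
      (Submodule.span_mono (Set.image_mono Set.inter_subset_right))
      (Submodule.span_mono (Set.image_mono Set.inter_subset_left)))
  have h'' : spanRank f (A ∪ E) =
      Module.finrank ℝ ↥(Submodule.span ℝ (f '' A) ⊔ Submodule.span ℝ (f '' E)) := by
    rw [spanRank, Set.image_union, Submodule.span_union]
  simp only [spanRank] at *
  omega

theorem spanRank_le_ncard (f : α → M) {E : Set α} (hE : E.Finite) :
    spanRank f E ≤ E.ncard := by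
  have := (hE.image f).fintype
  refine (finrank_span_le_card (R := ℝ) (f '' E)).trans ?_
  rw [← Set.ncard_eq_toFinset_card']
  exact Set.ncard_image_le hE

/-- A subset of a set of full `spanRank` has full `spanRank`. -/
theorem ncard_le_spanRank_of_subset [FiniteDimensional ℝ M] (f : α → M) {S F : Set α}
    (hS : S.Finite) (h : S.ncard ≤ spanRank f S) (hF : F ⊆ S) :
    F.ncard ≤ spanRank f F := by
  have h₁ := spanRank_union_add_inter_le f F (S \ F)
  rw [Set.union_sdiff_cancel hF] at h₁
  have h₂ := spanRank_le_ncard f (hS.sdiff (t := F))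
  have h₃ := Set.ncard_sdiff_add_ncard_of_subset hF hS
  omega

theorem spanRank_union_biUnion_add_sum_le [FiniteDimensional ℝ M] {ι : Type*} (f : α → M)
    (S : Set α) (E : ι → Set α) (T : Finset ι) :
    spanRank f (S ∪ ⋃ i ∈ T, E i) + ∑ i ∈ T, spanRank f (E i ∩ S) ≤
      spanRank f S + ∑ i ∈ T, spanRank f (E i) := by
  classical
  induction T using Finset.induction_on with
  | empty => simp
  | insert i T hi ih =>
    rw [Finset.sum_insert hi, Finset.sum_insert hi, Finset.set_biUnion_insert,
      Set.union_left_comm, Set.union_comm (E i)]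
    have h₁ := spanRank_union_add_inter_le f (S ∪ ⋃ j ∈ T, E j) (E i)
    have h₂ : spanRank f (E i ∩ S) ≤ spanRank f (E i ∩ (S ∪ ⋃ j ∈ T, E j)) :=
      spanRank_mono f (Set.inter_subset_inter_right _ Set.subset_union_left)
    omega

theorem linearIndependent_iff_det_mul_transpose_ne_zero {κ n : Type*} [Fintype κ]
    [DecidableEq κ] [Fintype n] (A : Matrix κ n ℝ) :
    LinearIndependent ℝ A.row ↔ (A * A.transpose).det ≠ 0 := by
  rw [← isUnit_iff_ne_zero, ← Matrix.isUnit_iff_isUnit_det]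
  constructor
  · intro h
    rw [← Matrix.linearIndependent_rows_iff_isUnit, linearIndependent_iff_card_eq_finrank_span,
      Set.finrank, ← Matrix.rank_eq_finrank_span_row, Matrix.rank_self_mul_transpose]
    exact h.rank_matrix.symm
  · intro h
    rw [linearIndependent_iff_card_eq_finrank_span,
      Set.finrank, ← Matrix.rank_eq_finrank_span_row, ← Matrix.rank_self_mul_transpose]
    exact (Matrix.rank_of_isUnit _ h).symm

/-- Linear independence survives along a line with finitely many exceptions. -/
theorem finite_setOf_not_linearIndependent_add_smul {κ n : Type*} [Fintype κ] [Fintype n]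
    (a b : κ → n → ℝ) (h : LinearIndependent ℝ a) :
    {t : ℝ | ¬ LinearIndependent ℝ (fun k => a k + t • b k)}.Finite := by
  classical
  let P : Matrix κ n (Polynomial ℝ) :=
    Matrix.of fun k j => Polynomial.C (a k j) + Polynomial.X * Polynomial.C (b k j)
  have hP : ∀ t : ℝ, ((P * P.transpose).det.eval t ≠ 0 ↔
      LinearIndependent ℝ (fun k => a k + t • b k)) := by
    intro t
    have h₁ : P.map (Polynomial.evalRingHom t) = Matrix.of (fun k => a k + t • b k) := by
      ext k j
      simp [P, mul_comm t]
    rw [← Polynomial.coe_evalRingHom, RingHom.map_det, RingHom.mapMatrix_apply,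
      Matrix.map_mul, Matrix.transpose_map, h₁,
      ← linearIndependent_iff_det_mul_transpose_ne_zero]
    rfl
  have h₀ : (P * P.transpose).det ≠ 0 := by
    intro h₀
    have h₁ := (hP 0).2 (by simpa using h)
    simp [h₀] at h₁
  refine (Polynomial.finite_setOfPred_isRoot h₀).subset fun t ht => ?_
  by_contra hroot
  exact ht ((hP t).1 hroot)

theorem finite_setOf_spanRank_add_smul_lt {n : Type*} [Fintype n] (a b : α → n → ℝ)
    (E : Set α) :
    {t : ℝ | spanRank (fun e => a e + t • b e) E < spanRank a E}.Finite := by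
  obtain ⟨F, hFE, -, hspan, hli⟩ := exists_linearIndepOn_extension
    (linearIndepOn_empty ℝ a) (Set.empty_subset E)
  have : Finite F := hli.finite
  have := Fintype.ofFinite F
  refine (finite_setOf_not_linearIndependent_add_smul (fun k : F => a k) (fun k : F => b k)
    hli).subset fun t ht hind => ?_
  refine not_lt.2 ?_ (Set.mem_ofPred_eq ▸ ht)
  calc spanRank a E ≤ spanRank a F := Submodule.finrank_mono (Submodule.span_le.2 hspan)
    _ ≤ F.ncard := spanRank_le_ncard a F.toFinite
    _ = spanRank (fun e => a e + t • b e) F := by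
      rw [spanRank, Set.image_eq_range, finrank_span_eq_card hind, ← Nat.card_eq_fintype_card]
      rfl
    _ ≤ spanRank (fun e => a e + t • b e) E := spanRank_mono _ hFE

end LinearAlgebra

/-- Two edge sets attain large rigidity ranks simultaneously. -/
theorem exists_spanRank_edgeRow_ge [Fintype V] [DecidableEq V] (E F : Set (Sym2 V))
    (p q : V → Fin 3 → ℝ) :
    ∃ w : V → Fin 3 → ℝ, spanRank (edgeRow p) E ≤ spanRank (edgeRow w) E ∧
      spanRank (edgeRow q) F ≤ spanRank (edgeRow w) F := by
  have h₁ := finite_setOf_spanRank_add_smul_lt (edgeRow p) (edgeRow (q - p)) E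
  have h₂ := (finite_setOf_spanRank_add_smul_lt (edgeRow q) (edgeRow (p - q)) F).preimage
    (f := fun t : ℝ => 1 - t) (sub_right_injective.injOn)
  obtain ⟨t, ht⟩ := (h₁.union h₂).exists_notMem
  simp only [← edgeRow_add_smul, Set.mem_union, Set.mem_ofPred_eq, Set.mem_preimage, not_or,
    not_lt] at ht
  refine ⟨p + t • (q - p), ht.1, ?_⟩
  have hw : p + t • (q - p) = q + (1 - t) • (p - q) := by module
  exact hw ▸ ht.2

/-- The edges of `G` inside `X` have rank at most the generic rank of `G.induce X`. -/
theorem spanRank_edgeRow_le_genRank_induce [Fintype V] [DecidableEq V] (G : SimpleGraph V)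
    (X : Set V) (p : V → Fin 3 → ℝ) :
    spanRank (edgeRow p) {e ∈ G.edgeSet | ∀ v ∈ e, v ∈ X} ≤ genRank (G.induce X) := by
  refine le_trans ?_ (rigidityRank_le_genRank (G.induce X) (fun x => p x))
  rw [rigidityRank_eq_spanRank]
  let L : (X × Fin 3 → ℝ) →ₗ[ℝ] (V × Fin 3 → ℝ) :=
    Function.ExtendByZero.linearMap ℝ (Prod.map Subtype.val id)
  have hinj : Function.Injective (Prod.map Subtype.val id : X × Fin 3 → V × Fin 3) :=
    Subtype.val_injective.prodMap Function.injective_id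
  have hL : ∀ x y : X, L (rigidityRow (fun x => p x) x y) = rigidityRow p x y := by
    intro x y
    funext ⟨v, i⟩
    by_cases hv : v ∈ X
    · have := hinj.extend_apply (rigidityRow (fun x : X => p x) x y) 0 (⟨v, hv⟩, i)
      refine this.trans ?_
      simp [rigidityRow, Subtype.ext_iff]
    · have hx : v ≠ x := fun h => hv (h ▸ x.2)
      have hy : v ≠ y := fun h => hv (h ▸ y.2)
      refine (Function.extend_apply' _ _ _ ?_).trans ?_
      · rintro ⟨⟨u, j⟩, hu⟩
        have huv : (u : V) = v := congrArg Prod.fst hu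
        exact hv (huv ▸ u.2)
      · simp [rigidityRow, hx, hy]
  refine le_trans (Submodule.finrank_mono ?_) (Submodule.finrank_map_le L _)
  rw [Submodule.map_span]
  refine Submodule.span_mono ?_
  rintro _ ⟨e, ⟨he, heX⟩, rfl⟩
  induction e with
  | _ x y =>
    have hx : x ∈ X := heX x (Sym2.mem_mk_left x y)
    have hy : y ∈ X := heX y (Sym2.mem_mk_right x y)
    exact ⟨_, ⟨s(⟨x, hx⟩, ⟨y, hy⟩), he, rfl⟩, hL ⟨x, hx⟩ ⟨y, hy⟩⟩

/-- Double counting of the pairs in `S` together with the clusters containing them. -/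
theorem sum_ncard_eq_sum_coverDeg [Finite V] (𝒳 : Finset (Set V)) (S : Finset (Sym2 V)) :
    ∑ X ∈ 𝒳, {e : Sym2 V | e ∈ S ∧ ∀ v ∈ e, v ∈ X}.ncard = ∑ e ∈ S, coverDeg 𝒳 e := by
  classical
  convert Finset.sum_card_bipartiteAbove_eq_sum_card_bipartiteBelow
    (s := 𝒳) (t := S) (fun X e => ∀ v ∈ e, v ∈ X) using 2 with X _ e _
  · rw [← Set.ncard_coe_finset]
    simp [Finset.bipartiteAbove]
  · rw [coverDeg, ← Set.ncard_coe_finset]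
    simp [Finset.bipartiteBelow]

/-- If a graph `G` has an independent 2-thin cover `𝒳`, then
`rank₃(G) ≤ IE(G, 𝒳) = ∑_{X ∈ 𝒳} rank₃(G_{S(𝒳)}[X]) - ∑_{e ∈ S(𝒳)} (d(𝒳, e) - 1)`. -/
theorem twoThinCover_rank_bound {V : Type*} [Fintype V] [DecidableEq V]
    (G : SimpleGraph V) (𝒳 : Finset (Set V))
    (hcover : IsTwoThinCover G 𝒳)
    (hind : IsIndependent (SimpleGraph.fromEdgeSet (sharedSet 𝒳))) :
    (genRank G : ℤ) ≤
      (∑ X ∈ 𝒳, (genRank ((G ⊔ SimpleGraph.fromEdgeSet (sharedSet 𝒳)).induce X) : ℤ)) -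
        ∑ᶠ e ∈ sharedSet 𝒳, ((coverDeg 𝒳 e : ℤ) - 1) := by
  classical
  set S := sharedSet 𝒳 with hSdef
  set H := G ⊔ SimpleGraph.fromEdgeSet S with hH
  have hSedge : (SimpleGraph.fromEdgeSet S).edgeSet = S := by
    rw [SimpleGraph.edgeSet_fromEdgeSet, sdiff_eq_left, Set.disjoint_left]
    rintro _ ⟨x, y, hxy, rfl, -⟩ hd
    exact hxy (by simpa using hd)
  obtain ⟨p, hp⟩ := exists_rigidityRank_eq_genRank G
  obtain ⟨q, hq⟩ := exists_rigidityRank_eq_genRank (SimpleGraph.fromEdgeSet S)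
  rw [rigidityRank_eq_spanRank] at hp hq
  rw [hind, hSedge] at hq
  obtain ⟨w, hwG, hwS⟩ := exists_spanRank_edgeRow_ge G.edgeSet S p q
  rw [hp] at hwG
  rw [hq] at hwS
  let E : Set V → Set (Sym2 V) := fun X => {e ∈ H.edgeSet | ∀ v ∈ e, v ∈ X}
  have hES : ∀ X, E X ∩ S = {e | e ∈ S.toFinset ∧ ∀ v ∈ e, v ∈ X} := by
    intro X
    ext e
    have hSH : e ∈ S → e ∈ H.edgeSet := fun he =>
      SimpleGraph.edgeSet_mono le_sup_right (hSedge.symm ▸ he)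
    simp only [E, Set.mem_inter_iff, Set.mem_ofPred_eq, Set.mem_toFinset]
    tauto
  have hcov : G.edgeSet ⊆ S ∪ ⋃ X ∈ 𝒳, E X := by
    intro e he
    induction e with
    | _ x y =>
      obtain ⟨X, hX, hx, hy⟩ := hcover.2.2 x y he
      refine Or.inr (Set.mem_biUnion hX ⟨SimpleGraph.edgeSet_mono le_sup_left he, ?_⟩)
      simp [hx, hy]
  have hrank := spanRank_mono (edgeRow w) hcov
  have hsub := spanRank_union_biUnion_add_sum_le (edgeRow w) S E 𝒳
  have hS := spanRank_le_ncard (edgeRow w) S.toFinite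
  have hinter : ∑ e ∈ S.toFinset, coverDeg 𝒳 e ≤ ∑ X ∈ 𝒳, spanRank (edgeRow w) (E X ∩ S) := by
    rw [← sum_ncard_eq_sum_coverDeg]
    refine Finset.sum_le_sum fun X _ => ?_
    rw [← hES]
    exact ncard_le_spanRank_of_subset _ S.toFinite hwS Set.inter_subset_right
  have hind_le : ∑ X ∈ 𝒳, spanRank (edgeRow w) (E X) ≤ ∑ X ∈ 𝒳, genRank (H.induce X) :=
    Finset.sum_le_sum fun X _ => spanRank_edgeRow_le_genRank_induce H X w
  rw [finsum_mem_eq_toFinset_sum, Finset.sum_sub_distrib, Finset.sum_const, nsmul_one,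
    ← Set.ncard_eq_toFinset_card']
  zify at hwG hrank hsub hS hinter hind_le
  linarith

end Rigidity
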